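/- If a position G has no 3-chains and size(G) is even, then v(G) ≡ size(G) ≡ c(G) (mod 4). -/

import Mathlib

namespace DotsAndBoxes

/-- A component of a Dots & Boxes endgame position: an `n`-chain or an `n`-loop. -/
inductive Component : Type where
  | chain (n : ℕ)
  | loop (n : ℕ)
deriving DecidableEq

namespace Component

/-- The number of boxes in a component. -/
def size : Component → ℕ
  | chain n => n
  | loop n => n

def isChain : Component → Bool
  | chain _ => true
  | loop _ => false

def isLoop : Component → Bool
  | chain _ => false
  | loop _ => true

/-- A chain must have length at least 3; a loop must have even length at least 4. -/
def Valid : Component → Prop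
  | chain n => 3 ≤ n
  | loop n => 4 ≤ n ∧ Even n

end Component

/-- A position is a finite multiset of components. -/
abbrev Position := Multiset Component

def Position.Valid (G : Position) : Prop := ∀ C ∈ G, C.Valid

/-- The number of unclaimed boxes in a position. -/
def size (G : Position) : ℕ := (G.map Component.size).sum

/-- The number of chains of a position. -/
def numChains (G : Position) : ℕ := Multiset.card (G.filter fun C => C.isChain = true)

/-- The number of loops of a position. -/
def numLoops (G : Position) : ℕ := Multiset.card (G.filter fun C => C.isLoop = true)

/-- θ(G), the number of 3-chains. -/
def theta (G : Position) : ℕ := G.count (Component.chain 3)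

/-- f(G), the number of 4-loops. -/
def numF (G : Position) : ℕ := G.count (Component.loop 4)

/-- s(G), the number of 6-loops. -/
def numS (G : Position) : ℕ := G.count (Component.loop 6)

open Classical in
/-- The terminal bonus tb(G). -/
noncomputable def tb (G : Position) : ℤ :=
  if G = 0 then 0
  else if ∀ C ∈ G, C.isLoop = true then 8
  else if (∃ C ∈ G, C.isLoop = true) ∧ Component.chain 3 ∈ G ∧
      (∀ C ∈ G, C.isChain = true → C = Component.chain 3) then 6
  else 4

/-- The controlled value c(G). -/
noncomputable def cval (G : Position) : ℤ :=
  (size G : ℤ) - 4 * (numChains G : ℤ) - 8 * (numLoops G : ℤ) + tb G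

/-- The score v(G;C) of opening component `C`, given that the remainder of the
position has value `w`. -/
def openVal (C : Component) (w : ℤ) : ℤ :=
  match C with
  | Component.chain n => ((n : ℤ) - 2) + |w - 2|
  | Component.loop n => ((n : ℤ) - 4) + |w - 4|

/-- Auxiliary recursion (on the number of components) for the value `v`. -/
noncomputable def valueAux : ℕ → Position → ℤ
  | 0, _ => 0
  | n + 1, G =>
    if G = 0 then 0
    else sInf { x : ℤ | ∃ C ∈ G, x = openVal C (valueAux n (G.erase C)) }

/-- The value v(G): v(∅) = 0, and v(G) = min over components C of G of v(G;C). -/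
noncomputable def value (G : Position) : ℤ := valueAux (Multiset.card G) G

/-- v(G;C), the value of G given that the opener has just opened C. -/
noncomputable def valueOpen (G : Position) (C : Component) : ℤ :=
  openVal C (value (G.erase C))

/-- Opening a component C of G is optimal if C ∈ G and v(G;C) = v(G). -/
def Optimal (G : Position) (C : Component) : Prop :=
  C ∈ G ∧ valueOpen G C = value G


lemma value_spec (G : Position) (hG : G ≠ 0) :
    (∃ C ∈ G, value G = openVal C (value (G.erase C))) ∧
    (∀ C ∈ G, value G ≤ openVal C (value (G.erase C))) := by
  obtain ⟨n, hn⟩ : ∃ n, Multiset.card G = n + 1 :=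
    Nat.exists_eq_succ_of_ne_zero (by simpa using hG)
  have hv : value G = sInf { x : ℤ | ∃ C ∈ G, x = openVal C (value (G.erase C)) } := by
    unfold value
    rw [hn, valueAux, if_neg hG]
    congr 1
    ext x
    constructor
    · rintro ⟨C, hC, rfl⟩
      refine ⟨C, hC, ?_⟩
      rw [Multiset.card_erase_of_mem hC, hn]; rfl
    · rintro ⟨C, hC, rfl⟩
      refine ⟨C, hC, ?_⟩
      rw [Multiset.card_erase_of_mem hC, hn]; rfl
  have hfin : { x : ℤ | ∃ C ∈ G, x = openVal C (value (G.erase C)) }.Finite := by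
    apply Set.Finite.subset
      (G.toFinset.image (fun C => openVal C (value (G.erase C)))).finite_toSet
    rintro x ⟨C, hC, rfl⟩
    simp only [Finset.coe_image, Set.mem_image, Finset.mem_coe, Multiset.mem_toFinset]
    exact ⟨C, hC, rfl⟩
  obtain ⟨D, hD⟩ := Multiset.exists_mem_of_ne_zero hG
  constructor
  · rw [hv]
    have hne : { x : ℤ | ∃ C ∈ G, x = openVal C (value (G.erase C)) }.Nonempty :=
      ⟨_, D, hD, rfl⟩
    exact Int.csInf_mem hne hfin.bddBelow
  · intro C hC
    rw [hv]
    exact csInf_le hfin.bddBelow ⟨C, hC, rfl⟩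

lemma size_erase (G : Position) (C : Component) (hC : C ∈ G) :
    (size G : ℤ) = C.size + size (G.erase C) := by
  conv_lhs => rw [← Multiset.cons_erase hC]
  simp [size]

lemma valid_erase {G : Position} (hG : G.Valid) (C : Component) :
    Position.Valid (G.erase C) := fun D hD => hG D (Multiset.mem_of_mem_erase hD)

lemma value_basic (n : ℕ) : ∀ G : Position, Multiset.card G = n → G.Valid →
    0 ≤ value G ∧ value G % 2 = (size G : ℤ) % 2 := by
  induction n with
  | zero =>
    intro G h _
    rw [Multiset.card_eq_zero] at h
    subst h
    simp [value, valueAux, size]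
  | succ n ih =>
    intro G h hG
    have h0 : G ≠ 0 := by rintro rfl; simp at h
    obtain ⟨⟨C, hC, hv⟩, -⟩ := value_spec G h0
    have hs := size_erase G C hC
    obtain ⟨i1, i2⟩ := ih (G.erase C)
      (by rw [Multiset.card_erase_of_mem hC, h]; rfl) (valid_erase hG C)
    have hCv := hG C hC
    cases C with
    | chain m =>
      simp only [openVal, Component.size, Component.Valid, abs_eq_max_neg] at *
      omega
    | loop m =>
      simp only [openVal, Component.size, Component.Valid, abs_eq_max_neg, Nat.even_iff] at *
      omega

/-- Opening an even component preserves the congruence. -/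
lemma even_case (G : Position) (C : Component) (hC : C ∈ G) (he : C.size % 2 = 0)
    (hev : (size G : ℤ) % 2 = 0)
    (ih : value (G.erase C) % 4 = (size (G.erase C) : ℤ) % 4)
    (hv : value G = openVal C (value (G.erase C))) :
    value G % 4 = (size G : ℤ) % 4 := by
  have hs := size_erase G C hC
  cases C with
  | chain m =>
    simp only [openVal, Component.size, abs_eq_max_neg] at *
    omega
  | loop m =>
    simp only [openVal, Component.size, abs_eq_max_neg] at *
    omega

set_option maxHeartbeats 2000000 in
lemma value_mod (n : ℕ) : ∀ G : Position, Multiset.card G = n → G.Valid →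
    Component.chain 3 ∉ G → (size G : ℤ) % 2 = 0 → value G % 4 = (size G : ℤ) % 4 := by
  induction n using Nat.strong_induction_on with
  | _ n ih =>
  intro G hcard hG h3 hev
  by_cases h0 : G = 0
  · subst h0
    simp [value, valueAux, size]
  obtain ⟨⟨C, hC, hv⟩, hmin⟩ := value_spec G h0
  have ih1 : ∀ D ∈ G, D.size % 2 = 0 →
      value (G.erase D) % 4 = (size (G.erase D) : ℤ) % 4 := by
    intro D hD hDe
    have hs := size_erase G D hD
    refine ih _ ?_ (G.erase D) rfl (valid_erase hG D)
      (fun h => h3 (Multiset.mem_of_mem_erase h)) (by omega)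
    rw [← hcard]; exact Multiset.card_erase_lt_of_mem hD
  -- it suffices to find an even component which is at least as good
  have key : ∀ D ∈ G, D.size % 2 = 0 → openVal D (value (G.erase D)) ≤ value G →
      value G % 4 = (size G : ℤ) % 4 := by
    intro D hD hDe hle
    exact even_case G D hD hDe hev (ih1 D hD hDe) (le_antisymm (hmin D hD) hle)
  by_cases hCe : C.size % 2 = 0
  · exact key C hC hCe hv.ge
  have hsC := size_erase G C hC
  have hCv := hG C hC
  obtain ⟨k, rfl⟩ : ∃ k, C = Component.chain k := by
    cases C with
    | chain k => exact ⟨k, rfl⟩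
    | loop k =>
      simp only [Component.Valid, Component.size, Nat.even_iff] at *
      omega
  have hk3 : k ≠ 3 := by rintro rfl; exact h3 hC
  have hk5 : 5 ≤ k := by
    simp only [Component.Valid, Component.size] at *
    omega
  have hne : G.erase (Component.chain k) ≠ 0 := by
    intro h
    rw [h] at hsC
    simp only [Component.size] at hsC hCe
    simp [size] at hsC hev
    omega
  obtain ⟨⟨D, hD, hw⟩, -⟩ := value_spec _ hne
  have hDG := Multiset.mem_of_mem_erase hD
  have hsD := size_erase _ D hD
  have hDv := hG D hDG
  obtain ⟨u0, u2⟩ := value_basic _ ((G.erase (Component.chain k)).erase D) rfl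
    (valid_erase (valid_erase hG _) _)
  by_cases hDe : D.size % 2 = 0
  · -- D is even: it is at least as good in G
    have hCD : Component.chain k ≠ D := by rintro rfl; exact hCe hDe
    have hCm : Component.chain k ∈ G.erase D := (Multiset.mem_erase_of_ne hCD).2 hC
    have hneD : G.erase D ≠ 0 := by intro h; rw [h] at hCm; simp at hCm
    obtain ⟨⟨L, hL, hvL⟩, hminD⟩ := value_spec _ hneD
    have hle := hminD _ hCm
    rw [Multiset.erase_comm] at hle
    obtain ⟨d0, d2⟩ := value_basic _ (G.erase D) rfl (valid_erase hG _)
    have hsGD := size_erase G D hDG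
    by_cases hgood : openVal D (value (G.erase D)) ≤ value G
    · exact key D hDG hDe hgood
    cases D with
    | chain m =>
      exfalso
      apply hgood
      simp only [openVal, Component.size, Component.Valid, abs_eq_max_neg] at *
      omega
    | loop m =>
      have hbad : value (G.erase (Component.loop m)) = 0 ∧ 6 ≤ m ∧ (m : ℤ) - 2 ≤ value G := by
        clear ih ih1 key hvL hmin hminD
        simp only [openVal, Component.size, Component.Valid, abs_eq_max_neg, Nat.even_iff] at *
        omega
      obtain ⟨b0, b6, bG⟩ := hbad
      have hLG := Multiset.mem_of_mem_erase hL
      have hLv := hG L hLG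
      obtain ⟨rfl, hu4⟩ : L = Component.loop 4 ∧
          value ((G.erase (Component.loop m)).erase L) = 4 := by
        rw [b0] at hvL
        cases L with
        | chain l =>
          simp only [openVal, Component.Valid, abs_eq_max_neg] at hvL hLv
          omega
        | loop l =>
          simp only [openVal, Component.Valid, abs_eq_max_neg] at hvL hLv
          rw [Component.loop.injEq]
          omega
      have hmL : Component.loop m ∈ G.erase (Component.loop 4) := by
        refine (Multiset.mem_erase_of_ne ?_).2 hDG
        rw [Ne, Component.loop.injEq]; omega
      have hne4 : G.erase (Component.loop 4) ≠ 0 := by intro h; rw [h] at hmL; simp at hmL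
      have h4 := (value_spec _ hne4).2 _ hmL
      rw [Multiset.erase_comm, hu4] at h4
      obtain ⟨e0, -⟩ := value_basic _ (G.erase (Component.loop 4)) rfl (valid_erase hG _)
      refine key (Component.loop 4) hLG (by simp [Component.size]) ?_
      simp only [openVal, abs_eq_max_neg] at h4 ⊢
      omega
  · -- D is an odd chain
    cases D with
    | loop m =>
      simp only [Component.Valid, Component.size, Nat.even_iff] at *
      omega
    | chain m =>
      have hm3 : m ≠ 3 := by rintro rfl; exact h3 hDG
      have ihu := ih _ (by
          rw [← hcard]
          exact lt_trans (Multiset.card_erase_lt_of_mem hD) (Multiset.card_erase_lt_of_mem hC))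
        ((G.erase (Component.chain k)).erase (Component.chain m)) rfl
        (valid_erase (valid_erase hG _) _)
        (fun h => h3 (Multiset.mem_of_mem_erase (Multiset.mem_of_mem_erase h)))
        (by simp only [Component.size] at *; omega)
      clear ih ih1 key hmin
      simp only [openVal, Component.size, Component.Valid, abs_eq_max_neg] at hv hw hsC hsD hCe hDe hDv
      have e1 : value (G.erase (Component.chain k)) % 4 =
          (size (G.erase (Component.chain k)) : ℤ) % 4 ∧
          3 ≤ value (G.erase (Component.chain k)) := by
        clear hv
        omega
      clear hw
      omega

lemma tb_mod (G : Position) (h : Component.chain 3 ∉ G) : tb G % 4 = 0 := by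
  unfold tb
  split_ifs with h1 h2 h3
  · rfl
  · rfl
  · exact absurd h3.2.1 h
  · rfl

/-- If G has no 3-chains and size(G) is even, then v(G) ≡ size(G) ≡ c(G) (mod 4). -/
theorem value_congr_mod_four (G : Position) (hG : G.Valid) (h : theta G = 0)
    (heven : Even (size G)) :
    value G % 4 = (size G : ℤ) % 4 ∧ (size G : ℤ) % 4 = cval G % 4 := by
  have h3 : Component.chain 3 ∉ G := Multiset.count_eq_zero.1 h
  have hev : (size G : ℤ) % 2 = 0 := by
    rw [Nat.even_iff] at heven
    omega
  refine ⟨value_mod _ G rfl hG h3 hev, ?_⟩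
  have := tb_mod G h3
  unfold cval
  omega

end DotsAndBoxes
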